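/- arXiv:2503.14039 — 2 statements merged into one kernel-verified Lean document; each statement's English description precedes it below -/
import Mathlib

section
/- For every function f : M → M on a finite set M and all integers i, j ≥ 1, the number of periodic orbits of the iterate f^[j] of length i satisfies D_i(f^[j]) = ∑_{n ≥ 1, n = i·gcd(n,j)} gcd(n, j) · D_n(f), the sum running over the finitely many n ≥ 1 with n = i·gcd(n, j). -/
/-- The orbit `{x, f x, …, f^[m-1] x}` as a finset. -/
def IsPeriodicOrbit {M : Type*} [DecidableEq M] (f : M → M) (m : ℕ) (s : Finset M) : Prop :=
  ∃ x : M, s = (Finset.range m).image (fun i => f^[i] x) ∧ s.card = m ∧ f^[m] x = x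

/-- `doldD f m` is the number of periodic orbits of `f` of length `m`. -/
noncomputable def doldD {M : Type*} [Fintype M] [DecidableEq M] (f : M → M) (m : ℕ) : ℕ :=
  Nat.card {s : Finset M // IsPeriodicOrbit f m s}

open Function in
theorem card_image_iterate_minimalPeriod {M : Type*} [DecidableEq M] (f : M → M) (x : M) :
    ((Finset.range (minimalPeriod f x)).image (fun i => f^[i] x)).card = minimalPeriod f x := by
  rw [Finset.card_image_of_injOn, Finset.card_range]
  simpa using iterate_injOn_Iio_minimalPeriod (f := f) (x := x)

open Function in
theorem isPeriodicOrbit_iff_minimalPeriod {M : Type*} [DecidableEq M] (f : M → M) {m : ℕ}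
    (hm : 1 ≤ m) (s : Finset M) :
    IsPeriodicOrbit f m s ↔
      ∃ x, minimalPeriod f x = m ∧ (Finset.range m).image (fun i => f^[i] x) = s := by
  constructor
  · rintro ⟨x, rfl, hcard, hx⟩
    refine ⟨x, le_antisymm (IsPeriodicPt.minimalPeriod_le hm hx) ?_, rfl⟩
    have hinj : Set.InjOn (fun i => f^[i] x) (Finset.range m) :=
      Finset.card_image_iff.mp (by rw [hcard, Finset.card_range])
    by_contra! hlt
    have hzero := hinj (by simpa using hlt) (Finset.mem_coe.mpr (Finset.mem_range.mpr hm))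
      (by simp)
    have hpos := IsPeriodicPt.minimalPeriod_pos hm hx
    omega
  · rintro ⟨x, rfl, rfl⟩
    exact ⟨x, rfl, card_image_iterate_minimalPeriod f x, iterate_minimalPeriod⟩

open Function in
theorem image_iterate_eq_of_mem {M : Type*} [DecidableEq M] (f : M → M) {m : ℕ} (hm : 1 ≤ m)
    {x y : M} (hx : minimalPeriod f x = m)
    (hy : y ∈ (Finset.range m).image (fun i => f^[i] x)) :
    minimalPeriod f y = m ∧
      (Finset.range m).image (fun i => f^[i] y) = (Finset.range m).image (fun i => f^[i] x) := by
  obtain ⟨k, -, rfl⟩ := Finset.mem_image.mp hy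
  have hper : minimalPeriod f (f^[k] x) = m := by
    rw [minimalPeriod_apply_iterate (minimalPeriod_pos_iff_mem_periodicPts.mp (by omega)), hx]
  refine ⟨hper, Finset.eq_of_subset_of_card_le ?_ ?_⟩
  · intro z hz
    obtain ⟨a, -, rfl⟩ := Finset.mem_image.mp hz
    refine Finset.mem_image.mpr ⟨(a + k) % m, Finset.mem_range.mpr (Nat.mod_lt _ hm), ?_⟩
    simp only [← hx, iterate_mod_minimalPeriod_eq, iterate_add_apply]
  · have h₁ := card_image_iterate_minimalPeriod f x
    have h₂ := card_image_iterate_minimalPeriod f (f^[k] x)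
    rw [hx] at h₁
    rw [hper] at h₂
    rw [h₁, h₂]

open Function in
theorem card_minimalPeriod_eq_mul_doldD {M : Type*} [Fintype M] [DecidableEq M] (f : M → M)
    {m : ℕ} (hm : 1 ≤ m) :
    (Finset.univ.filter (fun x => minimalPeriod f x = m)).card = m * doldD f m := by
  set A := Finset.univ.filter (fun x => minimalPeriod f x = m) with hA
  set O : M → Finset M := fun x => (Finset.range m).image (fun i => f^[i] x) with hO
  have hD : doldD f m = (A.image O).card := by
    rw [doldD, ← Nat.card_eq_finsetCard]
    refine Nat.card_congr (Equiv.subtypeEquivRight fun s => ?_)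
    simp [isPeriodicOrbit_iff_minimalPeriod f hm, hA, hO]
  rw [hD, mul_comm, Finset.card_eq_sum_card_image O A]
  refine Finset.sum_const_nat fun s hs => ?_
  obtain ⟨x, hxA, rfl⟩ := Finset.mem_image.mp hs
  have hx : minimalPeriod f x = m := by simpa [hA] using hxA
  have hfiber : A.filter (fun y => O y = O x) = O x := by
    ext y
    simp only [hA, Finset.mem_filter, Finset.mem_univ, true_and]
    refine ⟨fun h => ?_, image_iterate_eq_of_mem f hm hx⟩
    rw [← h.2]
    exact Finset.mem_image.mpr ⟨0, Finset.mem_range.mpr hm, rfl⟩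
  rw [hfiber]
  have hcard := card_image_iterate_minimalPeriod f x
  rwa [hx] at hcard

open Function in
theorem minimalPeriod_iterate_eq_iff {M : Type*} (f : M → M) {i j : ℕ} (hi : 1 ≤ i) (hj : 1 ≤ j)
    (x : M) :
    minimalPeriod f^[j] x = i ↔
      1 ≤ minimalPeriod f x ∧ minimalPeriod f x = i * (minimalPeriod f x).gcd j := by
  rw [minimalPeriod_iterate_eq_div_gcd (by omega)]
  have hg : 0 < (minimalPeriod f x).gcd j := Nat.gcd_pos_of_pos_right _ hj
  rw [Nat.div_eq_iff_eq_mul_left hg (Nat.gcd_dvd_left _ _)]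
  refine ⟨fun h => ⟨?_, h⟩, fun h => h.2⟩
  rw [h]
  exact Nat.mul_pos hi hg



theorem doldD_iterate
    {M : Type*} [Fintype M] [DecidableEq M] (f : M → M) (i j : ℕ)
    (hi : 1 ≤ i) (hj : 1 ≤ j) :
    doldD (f^[j]) i =
      ∑ n ∈ (Finset.Icc 1 (i * j)).filter (fun n => n = i * Nat.gcd n j),
        Nat.gcd n j * doldD f n := by
  refine Nat.eq_of_mul_eq_mul_left hi ?_
  rw [← card_minimalPeriod_eq_mul_doldD _ hi, Finset.mul_sum,
    Finset.card_eq_sum_card_fiberwise (f := Function.minimalPeriod f)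
      (t := (Finset.Icc 1 (i * j)).filter (fun n => n = i * Nat.gcd n j))]
  · refine Finset.sum_congr rfl fun n hn => ?_
    obtain ⟨hn₁, hn₂⟩ := Finset.mem_filter.mp hn
    have hn₀ : 1 ≤ n := (Finset.mem_Icc.mp hn₁).1
    rw [← mul_assoc, ← hn₂, ← card_minimalPeriod_eq_mul_doldD f hn₀, Finset.filter_filter]
    congr 1
    refine Finset.filter_congr fun x _ => ?_
    rw [minimalPeriod_iterate_eq_iff f hi hj]
    refine ⟨fun h => h.2, ?_⟩
    rintro rfl
    exact ⟨⟨hn₀, hn₂⟩, rfl⟩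
  · intro x hx
    have h := (minimalPeriod_iterate_eq_iff f hi hj x).mp (by simpa using hx)
    have hle : Function.minimalPeriod f x ≤ i * j :=
      h.2.trans_le (Nat.mul_le_mul_left i (Nat.gcd_le_right _ hj))
    exact Finset.mem_filter.mpr ⟨Finset.mem_Icc.mpr ⟨h.1, hle⟩, h.2⟩
end

section
/- Let M be a finite set, f : M → M a function, and l ≥ 0 an integer. For k ≥ 0 let N_{k,l} be the number of multisets s of cardinality k with elements in M such that the image multiset of s under f equals s and every element of M occurs in s with multiplicity at most l. Then in ℤ[[q]]: ∑_{k ≥ 0} N_{k,l} q^k = ∏_{m=1}^{#M} (1 + q^m + q^{2m} + ⋯ + q^{lm})^{D_m(f)}. -/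
open Finset

section Orbits

variable {M : Type*} [DecidableEq M] {f : M → M} {s : Finset M}

/-- A nonempty periodic orbit consists of the forward iterates of any of its points. -/
theorem IsPeriodicOrbit.mem_iff {m : ℕ} (hs : IsPeriodicOrbit f m s) {y : M} (hy : y ∈ s) (z : M) :
    z ∈ s ↔ ∃ n, f^[n] y = z := by
  obtain ⟨x, rfl, -, hx⟩ := hs
  have hper : Function.IsPeriodicPt f m x := hx
  have key (w : M) : w ∈ (range m).image (fun i => f^[i] x) ↔ ∃ n, f^[n] x = w := by
    have hm : 0 < m := by
      rcases Nat.eq_zero_or_pos m with rfl | h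
      · simp at hy
      · exact h
    simp only [mem_image, Finset.mem_range]
    constructor
    · rintro ⟨i, -, rfl⟩
      exact ⟨i, rfl⟩
    · rintro ⟨n, rfl⟩
      exact ⟨n % m, Nat.mod_lt _ hm, hper.iterate_mod_apply n⟩
  obtain ⟨i, hi, rfl⟩ := mem_image.1 hy
  rw [Finset.mem_range] at hi
  rw [key]
  constructor
  · rintro ⟨n, rfl⟩
    refine ⟨n + (m - i), ?_⟩
    rw [← Function.iterate_add_apply, add_assoc, Nat.sub_add_cancel hi.le,
      Function.iterate_add_apply, hx]
  · rintro ⟨n, rfl⟩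
    exact ⟨n + i, Function.iterate_add_apply f n i x⟩

theorem IsPeriodicOrbit.eq_of_mem {m n : ℕ} {t : Finset M} (hs : IsPeriodicOrbit f m s)
    (ht : IsPeriodicOrbit f n t) {x : M} (hxs : x ∈ s) (hxt : x ∈ t) : s = t := by
  ext z
  rw [hs.mem_iff hxs, ht.mem_iff hxt]

theorem IsPeriodicOrbit.image_eq {m : ℕ} (hs : IsPeriodicOrbit f m s) : s.image f = s := by
  have hmaps {x : M} (hx : x ∈ s) (n : ℕ) : f^[n] x ∈ s := (hs.mem_iff hx _).2 ⟨n, rfl⟩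
  ext z
  rw [mem_image]
  constructor
  · rintro ⟨x, hx, rfl⟩
    exact hmaps hx 1
  · intro hz
    obtain ⟨n, hn⟩ := (hs.mem_iff (hmaps hz 1) z).1 hz
    refine ⟨f^[n] z, hmaps hz n, ?_⟩
    rw [← Function.iterate_succ_apply' f n z]
    exact hn

theorem IsPeriodicOrbit.map_val_eq {m : ℕ} (hs : IsPeriodicOrbit f m s) :
    s.val.map f = s.val := by
  have hinj : Set.InjOn f s := card_image_iff.1 (by rw [hs.image_eq])
  rw [← image_val_of_injOn hinj, hs.image_eq]

theorem exists_isPeriodicOrbit_of_mem_periodicPts {x : M} (hx : x ∈ Function.periodicPts f) :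
    ∃ s : Finset M, x ∈ s ∧ IsPeriodicOrbit f #s s := by
  have hcard : #((range (Function.minimalPeriod f x)).image (fun i => f^[i] x)) =
      Function.minimalPeriod f x := by
    rw [card_image_of_injOn, card_range]
    rw [coe_range]
    exact Function.iterate_injOn_Iio_minimalPeriod
  refine ⟨(range (Function.minimalPeriod f x)).image (fun i => f^[i] x), ?_, x, ?_, rfl, ?_⟩
  · exact mem_image.2
      ⟨0, Finset.mem_range.2 (Function.minimalPeriod_pos_of_mem_periodicPts hx), rfl⟩
  · rw [hcard]
  · rw [hcard]
    exact Function.iterate_minimalPeriod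

end Orbits

section InvariantMultisets

variable {M : Type*} [DecidableEq M] {f : M → M} {s : Multiset M}

theorem Multiset.mem_periodicPts_of_map_eq_self (hs : s.map f = s) {x : M} (hx : x ∈ s) :
    x ∈ Function.periodicPts f := by
  have hmaps (y : s.toFinset) : f y ∈ s.toFinset := by
    have hy := Multiset.mem_map_of_mem f (Multiset.mem_toFinset.1 y.2)
    rw [hs] at hy
    exact Multiset.mem_toFinset.2 hy
  let g : s.toFinset → s.toFinset := fun y => ⟨f y, hmaps y⟩
  have hsurj : Function.Surjective g := by
    rintro ⟨z, hz⟩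
    rw [Multiset.mem_toFinset, ← hs, Multiset.mem_map] at hz
    obtain ⟨y, hy, rfl⟩ := hz
    exact ⟨⟨y, Multiset.mem_toFinset.2 hy⟩, rfl⟩
  have hsemi : Function.Semiconj Subtype.val g f := fun _ => rfl
  obtain ⟨n, hn, hper⟩ :=
    (Finite.injective_iff_surjective.2 hsurj).mem_periodicPts ⟨x, Multiset.mem_toFinset.2 hx⟩
  exact ⟨n, hn, hper.map hsemi⟩

theorem Multiset.count_le_count_iterate_of_map_eq_self (hs : s.map f = s) (x : M) (n : ℕ) :
    s.count x ≤ s.count (f^[n] x) := by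
  induction n with
  | zero => rfl
  | succ n ih =>
    rw [Function.iterate_succ_apply']
    refine ih.trans ?_
    conv_rhs => rw [← hs, count_map]
    rw [count_eq_card_filter_eq]
    exact card_le_card (monotone_filter_right s fun _ h => congrArg f h)

theorem Multiset.count_eq_count_of_mem_isPeriodicOrbit (hs : s.map f = s) {m : ℕ} {t : Finset M}
    (ht : IsPeriodicOrbit f m t) {x y : M} (hx : x ∈ t) (hy : y ∈ t) :
    s.count x = s.count y := by
  obtain ⟨i, rfl⟩ := (ht.mem_iff hx y).1 hy
  obtain ⟨j, hj⟩ := (ht.mem_iff hy x).1 hx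
  refine le_antisymm (count_le_count_iterate_of_map_eq_self hs x i) ?_
  conv_rhs => rw [← hj]
  exact count_le_count_iterate_of_map_eq_self hs _ j

end InvariantMultisets

section Cycles

variable {M : Type*} [Fintype M] [DecidableEq M]

open Classical in
/-- The nonempty periodic orbits of `f`, of all lengths. -/
noncomputable def cycles (f : M → M) : Finset (Finset M) :=
  {s | s.Nonempty ∧ IsPeriodicOrbit f #s s}

variable {f : M → M}

theorem mem_cycles {s : Finset M} : s ∈ cycles f ↔ s.Nonempty ∧ IsPeriodicOrbit f #s s := by
  simp [cycles]

theorem card_filter_cycles {m : ℕ} (hm : 1 ≤ m) : #{s ∈ cycles f | #s = m} = doldD f m := by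
  rw [doldD, ← Set.ncard_coe_finset]
  refine congrArg Set.ncard (Set.ext fun s => ?_)
  simp only [coe_filter, mem_cycles, Set.mem_ofPred_eq]
  constructor
  · rintro ⟨⟨-, hs⟩, rfl⟩
    exact hs
  · intro hs
    have hcard : #s = m := hs.choose_spec.2.1
    subst hcard
    exact ⟨⟨card_pos.1 hm, hs⟩, rfl⟩

/-- The multiset in which each point of the cycle `o` has multiplicity `c o`. -/
noncomputable def cycleMultiset (c : cycles f → ℕ) : Multiset M :=
  ∑ o, c o • o.1.val

theorem card_cycleMultiset (c : cycles f → ℕ) : (cycleMultiset c).card = ∑ o, c o * #o.1 := by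
  simp [cycleMultiset]

theorem map_cycleMultiset (c : cycles f → ℕ) : (cycleMultiset c).map f = cycleMultiset c := by
  rw [cycleMultiset, ← Multiset.coe_mapAddMonoidHom, map_sum]
  refine sum_congr rfl fun o _ => ?_
  rw [map_nsmul, Multiset.coe_mapAddMonoidHom, (mem_cycles.1 o.2).2.map_val_eq]

theorem count_cycleMultiset (c : cycles f → ℕ) (x : M) :
    (cycleMultiset c).count x = ∑ o, if x ∈ o.1 then c o else 0 := by
  rw [cycleMultiset, Multiset.count_sum']
  refine sum_congr rfl fun o _ => ?_
  rw [Multiset.count_nsmul, Multiset.count_eq_of_nodup o.1.nodup]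
  simp

theorem count_cycleMultiset_of_mem (c : cycles f → ℕ) (o : cycles f) {x : M} (hx : x ∈ o.1) :
    (cycleMultiset c).count x = c o := by
  rw [count_cycleMultiset, sum_eq_single o, if_pos hx]
  · intro o' _ hne
    refine if_neg fun hx' => hne (Subtype.ext ?_)
    exact (mem_cycles.1 o'.2).2.eq_of_mem (mem_cycles.1 o.2).2 hx' hx
  · exact fun h => (h (mem_univ o)).elim

theorem count_cycleMultiset_of_forall_notMem (c : cycles f → ℕ) {x : M}
    (hx : ∀ o : cycles f, x ∉ o.1) : (cycleMultiset c).count x = 0 := by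
  rw [count_cycleMultiset]
  exact sum_eq_zero fun o _ => if_neg (hx o)

theorem count_cycleMultiset_le_iff {c : cycles f → ℕ} {l : ℕ} :
    (∀ x, (cycleMultiset c).count x ≤ l) ↔ ∀ o, c o ≤ l := by
  constructor
  · intro h o
    obtain ⟨x, hx⟩ := (mem_cycles.1 o.2).1
    rw [← count_cycleMultiset_of_mem c o hx]
    exact h x
  · intro h x
    by_cases hx : ∃ o : cycles f, x ∈ o.1
    · obtain ⟨o, hx⟩ := hx
      rw [count_cycleMultiset_of_mem c o hx]
      exact h o
    · rw [count_cycleMultiset_of_forall_notMem c (not_exists.1 hx)]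
      exact l.zero_le

theorem cycleMultiset_injective : Function.Injective (cycleMultiset (f := f)) := by
  intro c d h
  funext o
  obtain ⟨x, hx⟩ := (mem_cycles.1 o.2).1
  rw [← count_cycleMultiset_of_mem c o hx, h, count_cycleMultiset_of_mem d o hx]

theorem exists_cycleMultiset_eq {s : Multiset M} (hs : s.map f = s) :
    ∃ c : cycles f → ℕ, cycleMultiset c = s := by
  refine ⟨fun o => s.count (mem_cycles.1 o.2).1.choose, Multiset.ext.2 fun x => ?_⟩
  by_cases hx : ∃ o : cycles f, x ∈ o.1
  · obtain ⟨o, hx⟩ := hx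
    rw [count_cycleMultiset_of_mem _ o hx]
    exact Multiset.count_eq_count_of_mem_isPeriodicOrbit hs (mem_cycles.1 o.2).2
      (mem_cycles.1 o.2).1.choose_spec hx
  · rw [count_cycleMultiset_of_forall_notMem _ (not_exists.1 hx), eq_comm, Multiset.count_eq_zero]
    intro hmem
    obtain ⟨t, hxt, ht⟩ :=
      exists_isPeriodicOrbit_of_mem_periodicPts (Multiset.mem_periodicPts_of_map_eq_self hs hmem)
    exact hx ⟨⟨t, mem_cycles.2 ⟨⟨x, hxt⟩, ht⟩⟩, hxt⟩

theorem card_invariant_multisets (f : M → M) (l k : ℕ) :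
    Nat.card {s : Multiset M // s.card = k ∧ s.map f = s ∧ ∀ x, s.count x ≤ l} =
      #{c ∈ Fintype.piFinset fun _ : cycles f => range (l + 1) | ∑ o, c o * #o.1 = k} := by
  rw [← Set.ncard_coe_finset, ← Set.ncard_image_of_injective _ cycleMultiset_injective]
  refine congrArg Set.ncard (Set.ext fun s => ?_)
  simp only [Set.mem_image, mem_coe, mem_filter, Fintype.mem_piFinset,
    Finset.mem_range, Nat.lt_succ_iff]
  constructor
  · rintro ⟨hk, hs, hl⟩
    obtain ⟨c, rfl⟩ := exists_cycleMultiset_eq hs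
    exact ⟨c, ⟨count_cycleMultiset_le_iff.1 hl, card_cycleMultiset c ▸ hk⟩, rfl⟩
  · rintro ⟨c, ⟨hl, hk⟩, rfl⟩
    exact ⟨(card_cycleMultiset c).trans hk, map_cycleMultiset c, count_cycleMultiset_le_iff.2 hl⟩

theorem prod_cycles {R : Type*} [CommMonoid R] (f : M → M) (g : ℕ → R) :
    ∏ o : cycles f, g #o.1 = ∏ m ∈ Icc 1 (Fintype.card M), g m ^ doldD f m := by
  rw [prod_coe_sort (cycles f) fun o => g #o,
    ← prod_fiberwise_of_maps_to (t := Icc 1 (Fintype.card M)) (g := card)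
      fun o ho => mem_Icc.2 ⟨(mem_cycles.1 ho).1.card_pos, card_le_univ o⟩]
  refine prod_congr rfl fun m hm => ?_
  rw [← card_filter_cycles (mem_Icc.1 hm).1]
  exact prod_eq_pow_card fun o ho => congrArg g (mem_filter.1 ho).2

end Cycles


theorem boundedMultiplicity_genFun
    {M : Type*} [Fintype M] [DecidableEq M] (f : M → M) (l : ℕ) :
    (PowerSeries.mk fun k =>
        (Nat.card {s : Multiset M // Multiset.card s = k ∧ Multiset.map f s = s ∧
            ∀ x : M, s.count x ≤ l} : ℤ)) =
      ∏ m ∈ Finset.Icc 1 (Fintype.card M),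
        ((∑ i ∈ Finset.range (l + 1), (PowerSeries.X : PowerSeries ℤ) ^ (i * m)) ^ doldD f m) := by
  rw [← prod_cycles f fun m =>
    ∑ i ∈ range (l + 1), (PowerSeries.X : PowerSeries ℤ) ^ (i * m), prod_univ_sum]
  ext k
  rw [PowerSeries.coeff_mk, card_invariant_multisets, map_sum, card_filter, Nat.cast_sum]
  refine sum_congr rfl fun c _ => ?_
  rw [prod_pow_eq_pow_sum, PowerSeries.coeff_X_pow, Nat.cast_ite, Nat.cast_one, Nat.cast_zero]
  exact if_congr eq_comm rfl rfl
end
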